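/- FWER control of the improved tree-based (Meinshausen) procedure. Let ℋ be a finite collection of null hypotheses structured as a rooted tree (a unique root, each non-root hypothesis having exactly one parent, no cycles) such that every non-leaf hypothesis equals the intersection of its children: H = ⋂ children(H) whenever children(H) ≠ ∅. Let ℒ denote the set of leaves, L = |ℒ|, L_H the number of leaves that are descendants of H (counting H itself if H is a leaf), and for ℛ ⊆ ℋ let L'(ℛ) = |ℒ \ ℛ|. Suppose raw p-values {p_H}_{H∈ℋ} are given and define α_H(ℛ) = α·L_H / L'(ℛ) if all ancestors of H lie in ℛ and L'(ℛ) > 0, and α_H(ℛ) = 0 otherwise. Then the sequentially rejective procedure with successor function 𝒩(ℛ) = {H ∈ ℋ \ ℛ : p_H ≤ α_H(ℛ)} satisfies P_M(ℛ_∞ ⊆ ℱ(M)) ≥ 1 − α for every M ∈ 𝕄. -/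

import Mathlib

open MeasureTheory Set Classical

/-- The sequentially rejective procedure based on a (possibly random) successor
function `N`: `ℛ₀ = ∅`, `ℛ_{i+1} = ℛ_i ∪ N(ℛ_i)`. -/
def seqRej {ι Ω : Type*} (N : Set ι → Ω → Set ι) (ω : Ω) : ℕ → Set ι
  | 0 => ∅
  | n + 1 => seqRej N ω n ∪ N (seqRej N ω n) ω

/-- In a rooted tree given by the parent function `par` with root `root`
(`par root = root`), the node `i` is a leaf iff it has no children. -/
def IsLeaf {ι : Type*} (par : ι → ι) (root : ι) (i : ι) : Prop :=
  ∀ j, par j = i → j = root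

/-- `j` is a (weak) descendant of `i`: some iterate of the parent map sends `j`
to `i` (in particular every node is a descendant of itself). -/
def IsDesc {ι : Type*} (par : ι → ι) (j i : ι) : Prop :=
  ∃ n : ℕ, par^[n] j = i

/-- `j` is an ancestor of `i`: `j ≠ i` and `j` lies on the path from `i`
to the root. -/
def IsAnc {ι : Type*} (par : ι → ι) (j i : ι) : Prop :=
  j ≠ i ∧ IsDesc par i j

/-- In a tree in which every inner hypothesis is the intersection of its children, every
descendant of a true hypothesis is true. -/
lemma mem_hyp_of_isDesc {𝕄 ι : Type*} {hyp : ι → Set 𝕄} {root : ι} {par : ι → ι}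
    (hroot : par root = root)
    (hinter : ∀ i : ι, ¬ IsLeaf par root i →
      hyp i = ⋂ j ∈ {j : ι | par j = i ∧ j ≠ root}, hyp j)
    {M : 𝕄} {i j : ι} (hi : M ∈ hyp i) (hji : IsDesc par j i) : M ∈ hyp j := by
  obtain ⟨n, hn⟩ := hji
  induction n generalizing j with
  | zero =>
    obtain rfl : j = i := hn
    exact hi
  | succ n ih =>
    have hpar : M ∈ hyp (par j) := ih hn
    by_cases hj : j = root
    · rwa [hj, hroot, ← hj] at hpar
    · rw [hinter (par j) fun h => hj (h j rfl)] at hpar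
      exact Set.mem_iInter₂.1 hpar j ⟨rfl, hj⟩

/-- Two nodes with a common descendant are comparable in the descendant relation. -/
lemma isDesc_or_isDesc_of_common {ι : Type*} {par : ι → ι} {l i j : ι}
    (hi : IsDesc par l i) (hj : IsDesc par l j) : IsDesc par i j ∨ IsDesc par j i := by
  obtain ⟨n, rfl⟩ := hi
  obtain ⟨m, rfl⟩ := hj
  rcases le_total n m with h | h
  · exact Or.inl ⟨m - n, by rw [← Function.iterate_add_apply, Nat.sub_add_cancel h]⟩
  · exact Or.inr ⟨n - m, by rw [← Function.iterate_add_apply, Nat.sub_add_cancel h]⟩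

/-- The leaf sets below pairwise incomparable nodes are disjoint, so their cardinalities add up
to at most that of any set containing all of them. -/
lemma sum_ncard_leaves_le {ι : Type*} [Fintype ι] {par : ι → ι} {root : ι}
    (T : Finset ι) (S : Set ι)
    (hanti : ∀ i ∈ T, ∀ j ∈ T, IsDesc par i j → i = j)
    (hsub : ∀ i ∈ T, {l | IsLeaf par root l ∧ IsDesc par l i} ⊆ S) :
    ∑ i ∈ T, Set.ncard {l | IsLeaf par root l ∧ IsDesc par l i} ≤ Set.ncard S := by
  have hdisj : (T : Set ι).PairwiseDisjoint
      fun i => {l | IsLeaf par root l ∧ IsDesc par l i}.toFinset := by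
    intro i hi j hj hij
    rw [Function.onFun, Finset.disjoint_left]
    intro l hli hlj
    simp only [Set.mem_toFinset, Set.mem_ofPred_eq] at hli hlj
    rcases isDesc_or_isDesc_of_common hli.2 hlj.2 with h | h
    · exact hij (hanti i hi j hj h)
    · exact hij (hanti j hj i hi h).symm
  simp only [Set.ncard_eq_toFinset_card']
  rw [← Finset.card_biUnion hdisj]
  refine Finset.card_le_card fun l hl => ?_
  obtain ⟨i, hi, hl⟩ := Finset.mem_biUnion.1 hl
  exact Set.mem_toFinset.2 (hsub i hi (Set.mem_toFinset.1 hl))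

/-- If every step that starts inside `F` stays inside `F`, then so does the whole procedure. -/
lemma iUnion_seqRej_subset {ι Ω : Type*} {N : Set ι → Ω → Set ι} {ω : Ω} {F : Set ι}
    (h : ∀ R ⊆ F, N R ω ⊆ F) : (⋃ n, seqRej N ω n) ⊆ F := by
  refine Set.iUnion_subset fun n => ?_
  induction n with
  | zero => exact Set.empty_subset F
  | succ n ih => exact Set.union_subset ih (h _ ih)

/-- **FWER control of the improved tree-based (Meinshausen) procedure.**
The hypotheses (indexed by the finite type `ι`, `hyp i ⊆ 𝕄`) are structured as a
rooted tree via the parent function `par` (unique root, every node reaches the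
root, no cycles), and every non-leaf hypothesis is the intersection of its
children.  With `ℒ` the set of leaves, `L_H` the number of descendant leaves of
`H` and `L'(ℛ) = |ℒ \ ℛ|`, the critical value is `α·L_H / L'(ℛ)` when all
ancestors of `H` lie in `ℛ` and `L'(ℛ) > 0`, and `0` otherwise.  The sequentially
rejective procedure with successor `N(ℛ) = {H ∉ ℛ : p H ≤ α_H(ℛ)}` controls the
FWER at level `α`. -/
theorem meinshausen_tree_improved_fwer_control
    {Ω : Type*} [MeasurableSpace Ω] {𝕄 : Type*} {ι : Type*} [Fintype ι]
    (P : 𝕄 → Measure Ω) (hP : ∀ M, IsProbabilityMeasure (P M))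
    (hyp : ι → Set 𝕄) (hproper : ∀ i, hyp i ≠ Set.univ)
    (root : ι) (par : ι → ι) (hroot : par root = root)
    (hreach : ∀ i : ι, ∃ n : ℕ, par^[n] i = root)
    (hinter : ∀ i : ι, ¬ IsLeaf par root i →
      hyp i = ⋂ j ∈ {j : ι | par j = i ∧ j ≠ root}, hyp j)
    (α : ℝ) (hα0 : 0 ≤ α) (hα1 : α ≤ 1)
    (p : ι → Ω → ℝ) (hpmeas : ∀ i, Measurable (p i))
    (hprange : ∀ i ω, p i ω ∈ Set.Icc (0 : ℝ) 1)
    (hpval : ∀ (M : 𝕄) (i : ι), M ∈ hyp i → ∀ u ∈ Set.Icc (0 : ℝ) 1,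
      P M {ω | p i ω ≤ u} ≤ ENNReal.ofReal u)
    (N : Set ι → Ω → Set ι)
    (hN : ∀ R ω, N R ω = {i | i ∉ R ∧
      p i ω ≤ (if (∀ j, IsAnc par j i → j ∈ R) ∧
          0 < Set.ncard ({l | IsLeaf par root l} \ R) then
        α * (Set.ncard {l | IsLeaf par root l ∧ IsDesc par l i} : ℝ) /
          (Set.ncard ({l | IsLeaf par root l} \ R) : ℝ)
      else 0)}) :
    ∀ M : 𝕄,
      1 - ENNReal.ofReal α ≤ P M {ω | (⋃ n, seqRej N ω n) ⊆ {i | M ∉ hyp i}} := by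
  intro M
  have := hP M
  set F : Set ι := {i | M ∉ hyp i}
  set L : ι → ℕ := fun i => Set.ncard {l | IsLeaf par root l ∧ IsDesc par l i}
  set L' : ℕ := Set.ncard ({l | IsLeaf par root l} \ F)
  have hsub : ∀ i, M ∈ hyp i →
      {l | IsLeaf par root l ∧ IsDesc par l i} ⊆ {l | IsLeaf par root l} \ F :=
    fun i hi l hl => ⟨hl.1, not_not.2 (mem_hyp_of_isDesc hroot hinter hi hl.2)⟩
  have hLle : ∀ i, M ∈ hyp i → L i ≤ L' := fun i hi => Set.ncard_le_ncard (hsub i hi)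
  let T : Finset ι := Finset.univ.filter fun i => M ∈ hyp i ∧ ∀ j, IsAnc par j i → j ∈ F
  have hsum : ∑ i ∈ T, L i ≤ L' := by
    refine sum_ncard_leaves_le T _ (fun i hi j hj hij => ?_) fun i hi =>
      hsub i (Finset.mem_filter.1 hi).2.1
    by_contra hne
    exact (Finset.mem_filter.1 hi).2.2 j ⟨Ne.symm hne, hij⟩ (Finset.mem_filter.1 hj).2.1
  let a : ι → ℝ := fun i => if i ∈ T then α * L i / L' else 0
  have ha0 : ∀ i, 0 ≤ a i := fun i => by
    dsimp only [a]
    split_ifs <;> positivity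
  have ha1 : ∀ i, M ∈ hyp i → a i ≤ 1 := fun i hi => by
    dsimp only [a]
    split_ifs
    · have h : (L i : ℝ) ≤ L' := by exact_mod_cast hLle i hi
      refine div_le_one_of_le₀ ?_ (by positivity)
      nlinarith [(Nat.cast_nonneg (L i) : (0 : ℝ) ≤ L i)]
    · exact zero_le_one
  have hasum : ∑ i, a i ≤ α := by
    simp only [a, ← Finset.sum_filter, Finset.filter_mem_eq_inter, Finset.univ_inter]
    rw [← Finset.sum_div, ← Finset.mul_sum, mul_div_assoc]
    refine mul_le_of_le_one_right hα0 (div_le_one_of_le₀ ?_ (by positivity))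
    exact_mod_cast hsum
  have hmono : ∀ R ⊆ F, ∀ ω, ∀ i ∈ N R ω, M ∈ hyp i → p i ω ≤ a i := by
    intro R hR ω i hiN hi
    rw [hN] at hiN
    refine hiN.2.trans ?_
    split_ifs with hc
    · have hiT : i ∈ T :=
        Finset.mem_filter.2 ⟨Finset.mem_univ i, hi, fun j hj => hR (hc.1 j hj)⟩
      simp only [a, if_pos hiT]
      rcases Nat.eq_zero_or_pos L' with h0 | h0
      · have hLi : L i = 0 := Nat.le_zero.1 (h0 ▸ hLle i hi)
        change α * (L i : ℝ) / _ ≤ _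
        simp [hLi]
      · have hle : L' ≤ Set.ncard ({l | IsLeaf par root l} \ R) :=
          Set.ncard_le_ncard (Set.sdiff_subset_sdiff_right hR)
        exact div_le_div_of_nonneg_left (by positivity) (by exact_mod_cast h0)
          (by exact_mod_cast hle)
    · exact ha0 i
  set E : Set Ω := {ω | (⋃ n, seqRej N ω n) ⊆ F}
  have hcompl : Eᶜ ⊆ ⋃ i ∈ Finset.univ.filter (fun i => M ∈ hyp i), {ω | p i ω ≤ a i} := by
    intro ω hω
    by_contra hno
    refine hω (iUnion_seqRej_subset fun R hR i hi hiM => hno ?_)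
    exact Set.mem_iUnion₂.2
      ⟨i, Finset.mem_filter.2 ⟨Finset.mem_univ i, hiM⟩, hmono R hR ω i hi hiM⟩
  have hbound : P M Eᶜ ≤ ENNReal.ofReal α := calc
    P M Eᶜ ≤ ∑ i ∈ Finset.univ.filter (fun i => M ∈ hyp i), P M {ω | p i ω ≤ a i} :=
      (measure_mono hcompl).trans (measure_biUnion_finset_le _ _)
    _ ≤ ∑ i ∈ Finset.univ.filter (fun i => M ∈ hyp i), ENNReal.ofReal (a i) :=
      Finset.sum_le_sum fun i hi =>
        hpval M i (Finset.mem_filter.1 hi).2 _ ⟨ha0 i, ha1 i (Finset.mem_filter.1 hi).2⟩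
    _ ≤ ∑ i, ENNReal.ofReal (a i) :=
      Finset.sum_le_sum_of_subset (Finset.filter_subset _ _)
    _ = ENNReal.ofReal (∑ i, a i) := (ENNReal.ofReal_sum_of_nonneg fun i _ => ha0 i).symm
    _ ≤ ENNReal.ofReal α := ENNReal.ofReal_le_ofReal hasum
  rw [tsub_le_iff_right]
  calc (1 : ENNReal) = P M (E ∪ Eᶜ) := by rw [Set.union_compl_self, measure_univ]
    _ ≤ P M E + P M Eᶜ := measure_union_le _ _
    _ ≤ P M E + ENNReal.ofReal α := by gcongr
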